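/- For every integer k ≥ 2, let a = 0 1^k 0, b = 0 1^{k−1} 0 1, v = ab, and w = ba (concatenations). Then the pair (v,w) does not have property R, yet there exists a bijection φ: Ω_{v,w}(v) → Ω_{v,w}(w) such that ℙ_p(x) = ℙ_p(φ(x)) for every x and every p ∈ (0,1); in particular Win(v,w;p) = 1/2 for all p ∈ (0,1). -/

import Mathlib

open scoped BigOperators

/-- Bernoulli(p) weight of a binary word `u`: `ℙ_p(u) = p^{‖u‖₁} (1-p)^{‖u‖₀}`. -/
noncomputable def wProb (p : ℝ) (u : List Bool) : ℝ :=
  p ^ (u.count true) * (1 - p) ^ (u.count false)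

/-- Number of occurrences of `v` as a contiguous subword of `u`. -/
def occCount (v u : List Bool) : ℕ :=
  (List.range (u.length + 1)).countP (fun i => decide (v <+: u.drop i))

/-- `Ω_{v,w}(v)`: binary words having `v` as a suffix, containing `v` exactly once
as a subword, and not containing `w` as a subword.  (`Ω_{v,w}(w) = OmegaWin w v`.) -/
def OmegaWin (v w : List Bool) : Set (List Bool) :=
  {u | v <:+ u ∧ occCount v u = 1 ∧ ¬ (w <:+: u)}

/-- The win probability `Win(v,w;p) = ∑_{u ∈ Ω_{v,w}(v)} ℙ_p(u)`. -/
noncomputable def Win (v w : List Bool) (p : ℝ) : ℝ :=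
  ∑' u : OmegaWin v w, wProb p u

/-- The correlation polynomial `vw_p = ∑_{u ∈ O(v,w)} ℙ_p(u)⁻¹`, where `O(v,w)` is
the set of nonempty words that are simultaneously a suffix of `v` and a prefix of `w`. -/
noncomputable def corr (v w : List Bool) (p : ℝ) : ℝ :=
  ∑ i ∈ Finset.Icc 1 w.length,
    if w.take i <:+ v then (wProb p (w.take i))⁻¹ else 0

/-- `Ω*_{v,w}(v) = {x : x ++ v ∈ Ω_{v,w}(v)}` (with `x` possibly empty). -/
def OmegaStarV (v w : List Bool) : Set (List Bool) :=
  {x | x ++ v ∈ OmegaWin v w}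

/-- Property `R`: `Ω*_{v,w}(v) = Ω*_{v,w}(w)`. -/
def PropR (v w : List Bool) : Prop :=
  OmegaStarV v w = {x | x ++ w ∈ OmegaWin w v}

/-- `D(v,w)`: nonempty proper prefixes `v₁⋯v_{n-k}` of `v` (`1 ≤ k ≤ n-1`) such that
`w₁⋯w_k = v_{n-k+1}⋯v_n`. -/
def Dset (v w : List Bool) : Set (List Bool) :=
  {x | ∃ k, 1 ≤ k ∧ k ≤ v.length - 1 ∧ k ≤ w.length ∧
    x = v.take (v.length - k) ∧ w.take k = v.drop (v.length - k)}

/-- `F(v,w) = D(v,v) ∪ D(w,w) ∪ D(w,v) ∪ D(v,w)`. -/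
def Fset (v w : List Bool) : Set (List Bool) :=
  Dset v v ∪ Dset w w ∪ Dset w v ∪ Dset v w

/-- `a^m`: concatenation of `m` copies of the word `a`. -/
def wpow (a : List Bool) (m : ℕ) : List Bool :=
  (List.replicate m a).flatten


theorem occCount_cons (v : List Bool) (c : Bool) (l : List Bool) :
    occCount v (c :: l) = (if v <+: c :: l then 1 else 0) + occCount v l := by
  unfold occCount
  rw [List.length_cons, List.range_succ_eq_map, List.countP_cons, List.countP_map, add_comm]
  simp [Function.comp_def]

theorem occCount_nil {v : List Bool} (hv : v ≠ []) : occCount v [] = 0 := by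
  simp [occCount, hv]

theorem occCount_eq_zero_iff {v : List Bool} (hv : v ≠ []) (l : List Bool) :
    occCount v l = 0 ↔ ¬ v <:+: l := by
  induction l with
  | nil => simp [occCount_nil hv, hv]
  | cons c l ih => rw [occCount_cons, List.infix_cons_iff]; split_ifs <;> simp_all

theorem occCount_concat {v : List Bool} (hv : v ≠ []) (l : List Bool) (c : Bool) :
    occCount v (l ++ [c]) = occCount v l + if v <:+ l ++ [c] then 1 else 0 := by
  induction l with
  | nil =>
    have h : v <+: [c] ↔ v <:+ [c] := by
      simp [List.prefix_cons_iff, List.suffix_cons_iff, hv]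
    simp [occCount_cons, occCount_nil hv, h]
  | cons d l ih =>
    have hp : v <+: d :: (l ++ [c]) ↔ v = d :: l ++ [c] ∨ v <+: d :: l :=
      List.prefix_concat_iff (l₂ := d :: l)
    have hs : v <:+ d :: (l ++ [c]) ↔ v = d :: l ++ [c] ∨ v <:+ l ++ [c] := List.suffix_cons_iff
    rw [List.cons_append, occCount_cons, ih, occCount_cons]
    simp only [hp, hs]
    by_cases h : v = d :: l ++ [c]
    · have h1 : ¬ v <+: d :: l := fun h' => by simpa [h] using h'.length_le
      have h2 : ¬ v <:+ l ++ [c] := fun h' => by simpa [h] using h'.length_le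
      simp [h1, h2, ← h]
      omega
    · simp only [h, false_or]; omega

/-- Two distinct nonempty words of the same length. -/
structure Rivals (v w : List Bool) : Prop where
  ne : v ≠ w
  length_eq : v.length = w.length
  left_ne_nil : v ≠ []

theorem Rivals.symm {v w : List Bool} (h : Rivals v w) : Rivals w v where
  ne := h.ne.symm
  length_eq := h.length_eq.symm
  left_ne_nil := fun hw => h.left_ne_nil (by simpa [hw] using h.length_eq)

theorem Rivals.not_suffix {v w u : List Bool} (h : Rivals v w) (hv : v <:+ u) : ¬ w <:+ u :=
  fun hw => h.ne ((List.suffix_of_suffix_length_le hv hw h.length_eq.le).eq_of_length h.length_eq)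

/-- The words containing neither `v` nor `w`. -/
def avoiding (v w : List Bool) : Set (List Bool) :=
  {u | ¬ v <:+: u ∧ ¬ w <:+: u}

theorem mem_avoiding {v w u : List Bool} : u ∈ avoiding v w ↔ ¬ v <:+: u ∧ ¬ w <:+: u :=
  Iff.rfl

theorem avoiding_comm (v w : List Bool) : avoiding v w = avoiding w v := by
  ext u; simp only [mem_avoiding, and_comm]

theorem mem_avoiding_of_infix {v w x u : List Bool} (hu : u ∈ avoiding v w) (hx : x <:+: u) :
    x ∈ avoiding v w :=
  ⟨fun h => hu.1 (h.trans hx), fun h => hu.2 (h.trans hx)⟩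

theorem nil_mem_avoiding {v w : List Bool} (h : Rivals v w) : [] ∈ avoiding v w := by
  simp [mem_avoiding, h.left_ne_nil, h.symm.left_ne_nil]

theorem mem_omegaWin_iff {v w : List Bool} (h : Rivals v w) {u : List Bool} :
    u ∈ OmegaWin v w ↔ v <:+ u ∧ u.dropLast ∈ avoiding v w := by
  refine and_congr_right fun hu => ?_
  rcases u.eq_nil_or_concat' with rfl | ⟨l, c, rfl⟩
  · exact absurd (List.suffix_nil.1 hu) h.left_ne_nil
  rw [mem_avoiding, List.dropLast_concat, ← occCount_eq_zero_iff h.left_ne_nil,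
    List.infix_concat_iff]
  simp [occCount_concat h.left_ne_nil, hu, h.not_suffix hu]

/-- The words at which exactly one of `v` and `w` appears for the first time. -/
def hitting (v w : List Bool) : Set (List Bool) :=
  OmegaWin v w ∪ OmegaWin w v

theorem mem_hitting_iff {v w u : List Bool} (h : Rivals v w) :
    u ∈ hitting v w ↔ (v <:+ u ∨ w <:+ u) ∧ u.dropLast ∈ avoiding v w := by
  rw [hitting, Set.mem_union, mem_omegaWin_iff h, mem_omegaWin_iff h.symm, avoiding_comm w v,
    or_and_right]

theorem concat_mem_hitting_iff {v w u : List Bool} {c : Bool} (h : Rivals v w) :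
    u ++ [c] ∈ hitting v w ↔ u ∈ avoiding v w ∧ u ++ [c] ∉ avoiding v w := by
  rw [mem_hitting_iff h, List.dropLast_concat, mem_avoiding, mem_avoiding, List.infix_concat_iff,
    List.infix_concat_iff]
  tauto

theorem notMem_avoiding_of_mem_hitting {v w u : List Bool} (h : Rivals v w)
    (hu : u ∈ hitting v w) : u ∉ avoiding v w := fun h' =>
  ((mem_hitting_iff h).1 hu).1.elim (fun hv => h'.1 hv.isInfix) fun hw => h'.2 hw.isInfix

theorem disjoint_omegaWin {v w : List Bool} (h : Rivals v w) :
    Disjoint (OmegaWin v w) (OmegaWin w v) :=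
  Set.disjoint_left.2 fun _ hu hu' => h.not_suffix hu.1 hu'.1

theorem exists_prefix_mem_hitting {v w u : List Bool} (h : Rivals v w)
    (hu : u ∉ avoiding v w) : ∃ u' ∈ hitting v w, u' <+: u := by
  induction u using List.reverseRecOn with
  | nil => exact absurd (nil_mem_avoiding h) hu
  | append_singleton l c ih =>
    by_cases hl : l ∈ avoiding v w
    · exact ⟨_, (concat_mem_hitting_iff h).2 ⟨hl, hu⟩, List.prefix_rfl⟩
    · obtain ⟨u', hu', hp⟩ := ih hl
      exact ⟨u', hu', hp.trans (List.prefix_append _ _)⟩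

theorem mem_avoiding_of_prefix {v w x u : List Bool} (h : Rivals v w) (hu : u ∈ hitting v w)
    (hx : x <+: u) (hne : x ≠ u) : x ∈ avoiding v w := by
  rcases u.eq_nil_or_concat' with rfl | ⟨l, c, rfl⟩
  · exact absurd (List.prefix_nil.1 hx) hne
  have hl := ((concat_mem_hitting_iff h).1 hu).1
  exact mem_avoiding_of_infix hl ((List.prefix_concat_iff.1 hx).resolve_left hne).isInfix

theorem eq_of_prefix_of_mem_hitting {v w x y u : List Bool} (h : Rivals v w)
    (hx : x ∈ hitting v w) (hy : y ∈ hitting v w) (hxu : x <+: u) (hyu : y <+: u) : x = y := by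
  by_contra hne
  rcases List.prefix_or_prefix_of_prefix hxu hyu with hp | hp
  · exact notMem_avoiding_of_mem_hitting h hx (mem_avoiding_of_prefix h hy hp hne)
  · exact notMem_avoiding_of_mem_hitting h hy (mem_avoiding_of_prefix h hx hp (Ne.symm hne))

/-- The words `u ++ t` with `u ∈ A`. -/
def appendRight (A : Set (List Bool)) (t : List Bool) : Set (List Bool) :=
  (· ++ t) '' A

theorem disjoint_appendRight {v w s t : List Bool} {A B : Set (List Bool)} (h : Rivals v w)
    (hA : A ⊆ hitting v w) (hB : B ⊆ hitting v w) (hst : s.length ≠ t.length) :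
    Disjoint (appendRight A s) (appendRight B t) := by
  rw [Set.disjoint_left]
  rintro _ ⟨x, hx, rfl⟩ ⟨y, hy, hxy⟩
  have hp : y <+: x ++ s := ⟨t, hxy⟩
  obtain rfl := eq_of_prefix_of_mem_hitting h (hA hx) (hB hy) (List.prefix_append x s) hp
  exact hst (congrArg List.length (List.append_cancel_left hxy)).symm

/-- The first occurrence of `v` or `w` in `x ++ v` overlaps the final copy of `v`. -/
theorem exists_overlap {v w x : List Bool} (h : Rivals v w) (hx : x ∈ avoiding v w) :
    ∃ j, 1 ≤ j ∧ j ≤ v.length ∧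
      (v.take j <:+ v ∧ x ++ v.take j ∈ OmegaWin v w ∨
        v.take j <:+ w ∧ x ++ v.take j ∈ OmegaWin w v) := by
  obtain ⟨u, hu, hp⟩ := exists_prefix_mem_hitting (u := x ++ v) h
    fun h' => h'.1 (List.suffix_append _ _).isInfix
  have hxu : x <+: u := (List.prefix_or_prefix_of_prefix hp (List.prefix_append x v)).resolve_left
    fun hux => notMem_avoiding_of_mem_hitting h hu (mem_avoiding_of_infix hx hux.isInfix)
  obtain ⟨y, rfl⟩ := hxu
  have hy : y <+: v := (List.prefix_append_right_inj x).1 hp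
  have hy0 : y ≠ [] := by
    rintro rfl
    exact notMem_avoiding_of_mem_hitting h hu (by simpa using hx)
  refine ⟨y.length, List.length_pos_iff.2 hy0, hy.length_le, ?_⟩
  rw [← List.prefix_iff_eq_take.1 hy]
  have hs : y <:+ x ++ y := List.suffix_append _ _
  exact hu.imp (fun hu => ⟨List.suffix_of_suffix_length_le hs hu.1 hy.length_le, hu⟩)
    fun hu => ⟨List.suffix_of_suffix_length_le hs hu.1 (hy.length_le.trans h.length_eq.le), hu⟩

theorem append_drop_mem_appendRight {v w z u : List Bool} {j : ℕ} (h : Rivals v w) (hj : 1 ≤ j)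
    (hu : u ∈ hitting v w) (hz : z <:+ u) (hs : v.take j <:+ z) :
    u ++ v.drop j ∈ appendRight (avoiding v w) v := by
  obtain ⟨x, rfl⟩ := hs.trans hz
  refine ⟨x, mem_avoiding_of_prefix h hu (List.prefix_append _ _) fun he => ?_, by simp⟩
  have : v.take j = [] := by simpa using he
  rcases List.take_eq_nil_iff.1 this with h0 | h0
  · omega
  · exact h.left_ne_nil h0

/-- If the overlaps of prefixes of `v` with suffixes of `v` have lengths `i` and `v.length`, and
those with suffixes of `w` have lengths `j` and `l`, then every `x ++ v` with `x` avoiding both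
words splits at its first occurrence of `v` or `w` in exactly four ways. -/
theorem appendRight_avoiding {v w : List Bool} {i j l : ℕ} (h : Rivals v w)
    (hi : i ≤ v.length ∧ 1 ≤ i) (hj : j ≤ v.length ∧ 1 ≤ j) (hl : l ≤ v.length ∧ 1 ≤ l)
    (hvv : ∀ m, 1 ≤ m → m ≤ v.length → (v.take m <:+ v ↔ m = i ∨ m = v.length))
    (hvw : ∀ m, 1 ≤ m → m ≤ v.length → (v.take m <:+ w ↔ m = j ∨ m = l)) :
    appendRight (avoiding v w) v =
      appendRight (OmegaWin v w) [] ∪ appendRight (OmegaWin v w) (v.drop i) ∪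
        (appendRight (OmegaWin w v) (v.drop j) ∪ appendRight (OmegaWin w v) (v.drop l)) := by
  ext u
  constructor
  · rintro ⟨x, hx, rfl⟩
    have hsplit : ∀ m, x ++ v = (x ++ v.take m) ++ v.drop m := by simp
    obtain ⟨m, hm, hm', ⟨hs, hmem⟩ | ⟨hs, hmem⟩⟩ := exists_overlap h hx
    · rcases (hvv m hm hm').1 hs with rfl | rfl
      · exact Or.inl (Or.inr ⟨_, hmem, (hsplit m).symm⟩)
      · exact Or.inl (Or.inl ⟨_, hmem, by simp⟩)
    · rcases (hvw m hm hm').1 hs with rfl | rfl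
      · exact Or.inr (Or.inl ⟨_, hmem, (hsplit m).symm⟩)
      · exact Or.inr (Or.inr ⟨_, hmem, (hsplit m).symm⟩)
  · have hlen : 1 ≤ v.length := hi.2.trans hi.1
    rintro ((⟨u, hu, rfl⟩ | ⟨u, hu, rfl⟩) | (⟨u, hu, rfl⟩ | ⟨u, hu, rfl⟩))
    · simpa using append_drop_mem_appendRight (j := v.length) h hlen (Or.inl hu) hu.1 (by simp)
    · exact append_drop_mem_appendRight h hi.2 (Or.inl hu) hu.1 ((hvv i hi.2 hi.1).2 (Or.inl rfl))
    · exact append_drop_mem_appendRight h hj.2 (Or.inr hu) hu.1 ((hvw j hj.2 hj.1).2 (Or.inl rfl))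
    · exact append_drop_mem_appendRight h hl.2 (Or.inr hu) hu.1 ((hvw l hl.2 hl.1).2 (Or.inr rfl))

/-- The number of ones and the number of zeros of a word. -/
def content (u : List Bool) : ℤ × ℤ :=
  (u.count true, u.count false)

theorem content_nil : content [] = 0 := rfl

theorem content_append (x y : List Bool) : content (x ++ y) = content x + content y := by
  simp [content]

theorem content_drop (v : List Bool) (j : ℕ) :
    content (v.drop j) = content v - content (v.take j) := by
  conv_rhs => rw [← List.take_append_drop j v, content_append]
  simp

theorem wProb_eq_of_content_eq {x y : List Bool} (h : content x = content y) (p : ℝ) :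
    wProb p x = wProb p y := by
  simp only [content, Prod.mk.injEq, Nat.cast_inj] at h
  simp [wProb, h.1, h.2]

/-- The words of `A` with content `c`. -/
def level (A : Set (List Bool)) (c : ℤ × ℤ) : Set (List Bool) :=
  {u | u ∈ A ∧ content u = c}

theorem finite_level (A : Set (List Bool)) (c : ℤ × ℤ) : (level A c).Finite := by
  refine (List.finite_length_eq Bool (c.1 + c.2).toNat).subset ?_
  rintro u ⟨-, rfl⟩
  have := List.count_true_add_count_false u
  change u.length = (((u.count true : ℕ) : ℤ) + ((u.count false : ℕ) : ℤ)).toNat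
  omega

theorem level_union (A B : Set (List Bool)) (c : ℤ × ℤ) :
    level (A ∪ B) c = level A c ∪ level B c := by
  ext u; exact or_and_right

theorem ncard_level_union {A B : Set (List Bool)} (h : Disjoint A B) (c : ℤ × ℤ) :
    (level (A ∪ B) c).ncard = (level A c).ncard + (level B c).ncard := by
  rw [level_union]
  exact Set.ncard_union_eq (h.mono (fun _ hu => hu.1) fun _ hu => hu.1) (finite_level A c)
    (finite_level B c)

theorem ncard_level_appendRight (A : Set (List Bool)) (t : List Bool) (c : ℤ × ℤ) :
    (level (appendRight A t) c).ncard = (level A (c - content t)).ncard := by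
  rw [← Set.ncard_image_of_injective (level A (c - content t)) (List.append_left_injective t)]
  congr 1
  ext u
  constructor
  · rintro ⟨⟨x, hx, rfl⟩, hc⟩
    exact ⟨x, ⟨hx, eq_sub_of_add_eq ((content_append x t).symm.trans hc)⟩, rfl⟩
  · rintro ⟨x, ⟨hx, hc⟩, rfl⟩
    exact ⟨⟨x, hx, rfl⟩, by simp [content_append, hc]⟩

theorem level_eq_empty {A : Set (List Bool)} {c : ℤ × ℤ} (hc : c.2 < 0) : level A c = ∅ := by
  refine Set.eq_empty_of_forall_notMem ?_
  rintro u ⟨-, rfl⟩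
  simp only [content] at hc
  omega

theorem ncard_level_appendRight_avoiding {v w : List Bool} {i j l : ℕ} (h : Rivals v w)
    (hi : 1 ≤ i) (hil : i < l) (hj : 1 ≤ j) (hjl : j < l) (hij : i ≠ j)
    (hl : l < v.length)
    (hvv : ∀ m, 1 ≤ m → m ≤ v.length → (v.take m <:+ v ↔ m = i ∨ m = v.length))
    (hvw : ∀ m, 1 ≤ m → m ≤ v.length → (v.take m <:+ w ↔ m = j ∨ m = l)) (c : ℤ × ℤ) :
    (level (avoiding v w) (c - content v)).ncard =
      (level (OmegaWin v w) c).ncard +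
        (level (OmegaWin v w) (c - content v + content (v.take i))).ncard +
      ((level (OmegaWin w v) (c - content v + content (v.take j))).ncard +
        (level (OmegaWin w v) (c - content v + content (v.take l))).ncard) := by
  have hV : OmegaWin v w ⊆ hitting v w := Set.subset_union_left
  have hW : OmegaWin w v ⊆ hitting v w := Set.subset_union_right
  rw [← ncard_level_appendRight, appendRight_avoiding h (i := i) (j := j) (l := l) (by omega)
    (by omega) (by omega) hvv hvw, ncard_level_union, ncard_level_union, ncard_level_union]
  · simp only [ncard_level_appendRight, content_drop, content_nil, sub_zero, ← sub_add]
  · exact disjoint_appendRight h hW hW (by simp; omega)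
  · exact disjoint_appendRight h hV hV (by simp; omega)
  · simp only [Set.disjoint_union_left, Set.disjoint_union_right]
    refine ⟨⟨?_, ?_⟩, ?_, ?_⟩ <;> exact disjoint_appendRight h hV hW (by simp; omega)

/-- Equality of the numbers of winning words of every content, for rivals all of whose mutual
overlaps have the same contents. -/
theorem ncard_level_omegaWin_eq {v w : List Bool} {i j l : ℕ} (h : Rivals v w)
    (hj : 1 ≤ j) (hji : j < i) (hil : i < l) (hl : l < v.length)
    (hvv : ∀ m, 1 ≤ m → m ≤ v.length → (v.take m <:+ v ↔ m = i ∨ m = v.length))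
    (hvw : ∀ m, 1 ≤ m → m ≤ v.length → (v.take m <:+ w ↔ m = j ∨ m = l))
    (hww : ∀ m, 1 ≤ m → m ≤ w.length → (w.take m <:+ w ↔ m = j ∨ m = w.length))
    (hwv : ∀ m, 1 ≤ m → m ≤ w.length → (w.take m <:+ v ↔ m = i ∨ m = l))
    (hcv : content v = content w) (hci : content (v.take i) = content (w.take i))
    (hcj : content (v.take j) = content (w.take j))
    (hcl : content (v.take l) = content (w.take l))
    (hpos : (content (v.take l)).2 < (content v).2) (c : ℤ × ℤ) :
    (level (OmegaWin v w) c).ncard = (level (OmegaWin w v) c).ncard := by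
  have step (c : ℤ × ℤ) : (level (OmegaWin v w) c).ncard +
      (level (OmegaWin w v) (c - content v + content (v.take l))).ncard =
      (level (OmegaWin w v) c).ncard +
      (level (OmegaWin v w) (c - content v + content (v.take l))).ncard := by
    have h1 := ncard_level_appendRight_avoiding h (by omega) hil hj (by omega) hji.ne' hl
      hvv hvw c
    have h2 := ncard_level_appendRight_avoiding h.symm hj (by omega) (by omega) hil
      hji.ne
      (hl.trans_eq h.length_eq) hww hwv c
    rw [avoiding_comm w v, ← hcv, ← hci, ← hcj, ← hcl] at h2
    omega
  suffices ∀ (n : ℕ) (c : ℤ × ℤ), c.2 < n →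
      (level (OmegaWin v w) c).ncard = (level (OmegaWin w v) c).ncard from
    this (c.2.toNat + 1) c (by omega)
  intro n
  induction n with
  | zero => intro c hc; rw [level_eq_empty (by simpa using hc), level_eq_empty (by simpa using hc)]
  | succ n ih =>
    intro c hc
    have := ih (c - content v + content (v.take l)) (by
      rw [Prod.snd_add, Prod.snd_sub]; push_cast at hc; omega)
    have := step c
    omega

theorem exists_bijective_of_ncard_level_eq {A B : Set (List Bool)}
    (h : ∀ c, (level A c).ncard = (level B c).ncard) :
    ∃ φ : A → B, Function.Bijective φ ∧ ∀ x : A, content x = content (φ x) := by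
  have key (c : ℤ × ℤ) : Nonempty ({x : A // content x = c} ≃ {x : B // content x = c}) := by
    have eA := Equiv.subtypeSubtypeEquivSubtypeInter (· ∈ A) (content · = c)
    have eB := Equiv.subtypeSubtypeEquivSubtypeInter (· ∈ B) (content · = c)
    have := (finite_level A c).to_subtype
    have := (finite_level B c).to_subtype
    obtain ⟨e⟩ := Finite.card_eq.1
      (show Nat.card (level A c) = Nat.card (level B c) from h c)
    exact ⟨eA.trans (e.trans eB.symm)⟩
  have e (c : ℤ × ℤ) := (key c).some
  let E : A ≃ B := (Equiv.sigmaFiberEquiv fun x : A => content x).symm.trans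
    ((Equiv.sigmaCongrRight e).trans (Equiv.sigmaFiberEquiv fun x : B => content x))
  exact ⟨E, E.bijective, fun x => (e (content x) ⟨x, rfl⟩).2.symm⟩

theorem take_suffix_iff {v w : List Bool} {n m : ℕ} {f g : ℕ → Bool} (hv : v.length = n)
    (hw : w.length = n) (hf : ∀ i < n, v[i]? = some (f i)) (hg : ∀ i < n, w[i]? = some (g i))
    (hm : m ≤ n) : v.take m <:+ w ↔ ∀ i < m, f i = g (n - m + i) := by
  have key : ∀ i < m, ((v.take m)[i]? = (w.drop (n - m))[i]? ↔ f i = g (n - m + i)) :=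
    fun i hi => by
      rw [List.getElem?_take_of_lt hi, List.getElem?_drop, hf i (by omega), hg _ (by omega),
        Option.some_inj]
  rw [List.suffix_iff_eq_drop, List.length_take, hv, hw, min_eq_left hm]
  refine ⟨fun h i hi => (key i hi).1 (by rw [h]), fun h => List.ext_getElem? fun i => ?_⟩
  rcases lt_or_ge i m with hi | hi
  · exact (key i hi).2 (h i hi)
  · rw [List.getElem?_eq_none (by simp; omega), List.getElem?_eq_none (by simp; omega)]

/-- The word `0 1^k 0`. -/
def wordA (k : ℕ) : List Bool := [false] ++ List.replicate k true ++ [false]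

/-- The word `0 1^(k-1) 0 1`. -/
def wordB (k : ℕ) : List Bool := [false] ++ List.replicate (k - 1) true ++ [false, true]

theorem length_wordA (k : ℕ) : (wordA k).length = k + 2 := by simp [wordA]

theorem length_wordB {k : ℕ} (hk : 2 ≤ k) : (wordB k).length = k + 2 := by
  simp [wordB]; omega

/-- The letters of `wordA k ++ wordB k`. -/
def letterAB (k i : ℕ) : Bool := decide (i ≠ 0 ∧ i ≠ k + 1 ∧ i ≠ k + 2 ∧ i ≠ 2 * k + 2)

/-- The letters of `wordB k ++ wordA k`. -/
def letterBA (k i : ℕ) : Bool := decide (i ≠ 0 ∧ i ≠ k ∧ i ≠ k + 2 ∧ i ≠ 2 * k + 3)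

theorem getElem?_wordA_append_wordB {k i : ℕ} (hk : 2 ≤ k) (hi : i < 2 * k + 4) :
    (wordA k ++ wordB k)[i]? = some (letterAB k i) := by
  simp only [wordA, wordB, letterAB, List.getElem?_append, List.length_append, List.length_cons,
    List.length_nil, List.length_replicate, List.getElem?_replicate, List.getElem?_cons,
    List.getElem?_nil]
  split_ifs <;> first | omega | (simp; omega)

theorem getElem?_wordB_append_wordA {k i : ℕ} (hk : 2 ≤ k) (hi : i < 2 * k + 4) :
    (wordB k ++ wordA k)[i]? = some (letterBA k i) := by
  simp only [wordA, wordB, letterBA, List.getElem?_append, List.length_append, List.length_cons,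
    List.length_nil, List.length_replicate, List.getElem?_replicate, List.getElem?_cons,
    List.getElem?_nil]
  split_ifs <;> first | omega | (simp; omega)

theorem rivals_wordA_wordB {k : ℕ} (hk : 2 ≤ k) :
    Rivals (wordA k ++ wordB k) (wordB k ++ wordA k) where
  ne h := by
    have := congrArg (·[k]?) h
    simp only [getElem?_wordA_append_wordB hk (show k < 2 * k + 4 by omega),
      getElem?_wordB_append_wordA hk (show k < 2 * k + 4 by omega), Option.some_inj,
      letterAB, letterBA, decide_eq_decide] at this
    omega
  length_eq := by simp [add_comm]
  left_ne_nil := by simp [wordA]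

theorem length_wordA_append_wordB {k : ℕ} (hk : 2 ≤ k) :
    (wordA k ++ wordB k).length = 2 * k + 4 := by
  rw [List.length_append, length_wordA, length_wordB hk]; omega

theorem length_wordB_append_wordA {k : ℕ} (hk : 2 ≤ k) :
    (wordB k ++ wordA k).length = 2 * k + 4 := by
  rw [List.length_append, length_wordA, length_wordB hk]; omega

theorem take_ab_suffix_ab_iff {k m : ℕ} (hk : 2 ≤ k) (hm : 1 ≤ m)
    (hm' : m ≤ (wordA k ++ wordB k).length) :
    (wordA k ++ wordB k).take m <:+ wordA k ++ wordB k ↔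
      m = 2 ∨ m = (wordA k ++ wordB k).length := by
  rw [length_wordA_append_wordB hk] at hm' ⊢
  rw [take_suffix_iff (length_wordA_append_wordB hk) (length_wordA_append_wordB hk)
    (fun _ => getElem?_wordA_append_wordB hk) (fun _ => getElem?_wordA_append_wordB hk) hm']
  simp only [letterAB, decide_eq_decide]
  constructor
  · intro h
    have h0 := h 0 (by omega)
    by_contra hne
    have h1 := h 1 (by omega)
    have := h k
    omega
  · intro h i hi
    omega

theorem take_ab_suffix_ba_iff {k m : ℕ} (hk : 2 ≤ k) (hm : 1 ≤ m)
    (hm' : m ≤ (wordA k ++ wordB k).length) :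
    (wordA k ++ wordB k).take m <:+ wordB k ++ wordA k ↔ m = 1 ∨ m = k + 2 := by
  rw [length_wordA_append_wordB hk] at hm'
  rw [take_suffix_iff (length_wordA_append_wordB hk) (length_wordB_append_wordA hk)
    (fun _ => getElem?_wordA_append_wordB hk) (fun _ => getElem?_wordB_append_wordA hk) hm']
  simp only [letterAB, letterBA, decide_eq_decide]
  constructor
  · intro h
    have h0 := h 0 (by omega)
    by_contra hne
    have h1 := h 2 (by omega)
    have := h k
    omega
  · intro h i hi
    omega

theorem take_ba_suffix_ba_iff {k m : ℕ} (hk : 2 ≤ k) (hm : 1 ≤ m)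
    (hm' : m ≤ (wordB k ++ wordA k).length) :
    (wordB k ++ wordA k).take m <:+ wordB k ++ wordA k ↔
      m = 1 ∨ m = (wordB k ++ wordA k).length := by
  rw [length_wordB_append_wordA hk] at hm' ⊢
  rw [take_suffix_iff (length_wordB_append_wordA hk) (length_wordB_append_wordA hk)
    (fun _ => getElem?_wordB_append_wordA hk) (fun _ => getElem?_wordB_append_wordA hk) hm']
  simp only [letterBA, decide_eq_decide]
  constructor
  · intro h
    have h0 := h 0 (by omega)
    by_contra hne
    have h1 := h (k + 1) (by omega)
    have := h (k + 3)
    omega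
  · intro h i hi
    omega

theorem take_ba_suffix_ab_iff {k m : ℕ} (hk : 2 ≤ k) (hm : 1 ≤ m)
    (hm' : m ≤ (wordB k ++ wordA k).length) :
    (wordB k ++ wordA k).take m <:+ wordA k ++ wordB k ↔ m = 2 ∨ m = k + 2 := by
  rw [length_wordB_append_wordA hk] at hm'
  rw [take_suffix_iff (length_wordB_append_wordA hk) (length_wordA_append_wordB hk)
    (fun _ => getElem?_wordB_append_wordA hk) (fun _ => getElem?_wordA_append_wordB hk) hm']
  simp only [letterBA, letterAB, decide_eq_decide]
  constructor
  · intro h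
    have h0 := h 0 (by omega)
    by_contra hne
    have h1 := h 1 (by omega)
    have := h k
    omega
  · intro h i hi
    omega

theorem ncard_level_omegaWin_ab_eq {k : ℕ} (hk : 2 ≤ k) (c : ℤ × ℤ) :
    (level (OmegaWin (wordA k ++ wordB k) (wordB k ++ wordA k)) c).ncard =
      (level (OmegaWin (wordB k ++ wordA k) (wordA k ++ wordB k)) c).ncard := by
  have hA : (wordA k ++ wordB k).take (k + 2) = wordA k := by
    rw [← length_wordA k, List.take_left]
  have hB : (wordB k ++ wordA k).take (k + 2) = wordB k := by
    rw [← length_wordB hk, List.take_left]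
  have hAB : content (wordA k) = content (wordB k) := by
    simp [content, wordA, wordB, List.count_replicate]; omega
  refine ncard_level_omegaWin_eq (j := 1) (i := 2) (l := k + 2) (rivals_wordA_wordB hk) le_rfl
    (by omega) (by omega) (by rw [length_wordA_append_wordB hk]; omega)
    (fun _ => take_ab_suffix_ab_iff hk) (fun _ => take_ab_suffix_ba_iff hk)
    (fun _ => take_ba_suffix_ba_iff hk) (fun _ => take_ba_suffix_ab_iff hk)
    ?_ ?_ ?_ ?_ ?_ c
  · rw [content_append, content_append, add_comm]
  · obtain ⟨n, rfl⟩ := Nat.exists_eq_add_of_le' hk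
    rfl
  · rfl
  · rw [hA, hB, hAB]
  · rw [hA, content_append]
    simp [content, wordB, List.count_replicate]

theorem not_propR_ab {k : ℕ} (hk : 2 ≤ k) : ¬ PropR (wordA k ++ wordB k) (wordB k ++ wordA k) := by
  intro hR
  have h := rivals_wordA_wordB hk
  have hlen := length_wordA_append_wordB hk
  have hlen' := length_wordB_append_wordA hk
  have hB := length_wordB hk
  have hnot : wordB k ∉ OmegaStarV (wordA k ++ wordB k) (wordB k ++ wordA k) := fun hm =>
    hm.2.2 ⟨[], wordB k, by simp⟩
  rw [hR] at hnot
  refine hnot ?_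
  have hav : wordB k ∈ avoiding (wordB k ++ wordA k) (wordA k ++ wordB k) :=
    ⟨fun h' => by have := h'.length_le; omega, fun h' => by have := h'.length_le; omega⟩
  obtain ⟨j, hj, hj', ⟨hs, hmem⟩ | ⟨hs, hmem⟩⟩ := exists_overlap h.symm hav
  · rcases (take_ba_suffix_ba_iff hk hj hj').1 hs with rfl | rfl
    · have hle := hmem.1.length_le
      rw [hlen', List.length_append (as := wordB k), List.length_take] at hle
      omega
    · rwa [List.take_length] at hmem
  · have hle := hmem.1.length_le
    rw [hlen, List.length_append (as := wordB k), List.length_take] at hle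
    rcases (take_ba_suffix_ab_iff hk hj hj').1 hs with rfl | rfl
    · omega
    · rw [← hB, List.take_left] at hmem
      have heq := hmem.1.eq_of_length (by rw [hlen, List.length_append]; omega)
      exact (h.ne (by rw [List.append_cancel_right heq])).elim

theorem wProb_append (p : ℝ) (x y : List Bool) : wProb p (x ++ y) = wProb p x * wProb p y := by
  simp only [wProb, List.count_append, pow_add]
  ring

theorem wProb_concat_true_add_false (p : ℝ) (x : List Bool) :
    wProb p (x ++ [true]) + wProb p (x ++ [false]) = wProb p x := by
  simp only [wProb_append]
  simp [wProb]
  ring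

theorem wProb_pos {p : ℝ} (hp : p ∈ Set.Ioo (0 : ℝ) 1) (u : List Bool) : 0 < wProb p u :=
  mul_pos (pow_pos hp.1 _) (pow_pos (sub_pos.2 hp.2) _)

/-- The binary words of length `n`. -/
noncomputable def words (n : ℕ) : Finset (List Bool) := (List.finite_length_eq Bool n).toFinset

theorem mem_words {n : ℕ} {u : List Bool} : u ∈ words n ↔ u.length = n :=
  Set.Finite.mem_toFinset _

theorem sum_words_succ (n : ℕ) (f : List Bool → ℝ) :
    ∑ u ∈ words (n + 1), f u = ∑ u ∈ words n, (f (u ++ [true]) + f (u ++ [false])) := by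
  have h (u : List Bool) : f (u ++ [true]) + f (u ++ [false]) = ∑ c : Bool, f (u ++ [c]) := by
    simp
  simp only [h]
  rw [← Finset.sum_product']
  symm
  refine Finset.sum_bij (fun x _ => x.1 ++ [x.2]) ?_ ?_ ?_ fun _ _ => rfl
  · rintro ⟨u, c⟩ hu
    simp only [Finset.mem_product, Finset.mem_univ, and_true, mem_words] at hu
    simp [mem_words, hu]
  · rintro ⟨u, c⟩ - ⟨u', c'⟩ - he
    simpa using he
  · intro u hu
    rcases u.eq_nil_or_concat' with rfl | ⟨l, c, rfl⟩
    · simp [mem_words] at hu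
    · exact ⟨(l, c), by simpa [mem_words] using hu, rfl⟩

/-- The total weight of the words of length `n` in `A`. -/
noncomputable def mass (p : ℝ) (A : Set (List Bool)) (n : ℕ) : ℝ :=
  ∑ u ∈ words n, A.indicator (wProb p) u

theorem indicator_wProb_nonneg {p : ℝ} (hp : p ∈ Set.Ioo (0 : ℝ) 1) (A : Set (List Bool)) :
    0 ≤ A.indicator (wProb p) :=
  Set.indicator_nonneg fun u _ => (wProb_pos hp u).le

theorem mass_nonneg {p : ℝ} (hp : p ∈ Set.Ioo (0 : ℝ) 1) (A : Set (List Bool)) (n : ℕ) :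
    0 ≤ mass p A n :=
  Finset.sum_nonneg fun u _ => indicator_wProb_nonneg hp A u

theorem mass_zero (p : ℝ) (A : Set (List Bool)) : mass p A 0 = A.indicator (wProb p) [] := by
  have : words 0 = {[]} := by ext u; simp [mem_words]
  simp [mass, this]

theorem mass_take (p : ℝ) (A : Set (List Bool)) (n m : ℕ) :
    mass p {u | u.take n ∈ A} (n + m) = mass p A n := by
  classical
  induction m with
  | zero =>
    refine Finset.sum_congr rfl fun u hu => ?_
    rw [mem_words] at hu
    have : u ∈ {u : List Bool | u.take n ∈ A} ↔ u ∈ A := by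
      change u.take n ∈ A ↔ _
      rw [List.take_of_length_le hu.le]
    simp only [Set.indicator_apply, this]
  | succ m ih =>
    rw [← ih, mass, ← add_assoc, sum_words_succ]
    refine Finset.sum_congr rfl fun u hu => ?_
    rw [mem_words] at hu
    have (c : Bool) : u ++ [c] ∈ {u : List Bool | u.take n ∈ A} ↔
        u ∈ {u : List Bool | u.take n ∈ A} := by
      change (u ++ [c]).take n ∈ A ↔ u.take n ∈ A
      rw [List.take_append_of_le_length (by omega)]
    simp only [Set.indicator_apply, this]
    split_ifs
    · exact wProb_concat_true_add_false p u
    · exact add_zero 0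

theorem mass_avoiding_succ {v w : List Bool} (h : Rivals v w) (p : ℝ) (n : ℕ) :
    mass p (avoiding v w) (n + 1) + mass p (hitting v w) (n + 1) = mass p (avoiding v w) n := by
  classical
  rw [← mass_take p (avoiding v w) n 1, mass, mass, mass, ← Finset.sum_add_distrib]
  refine Finset.sum_congr rfl fun u hu => ?_
  rw [mem_words] at hu
  rcases u.eq_nil_or_concat' with rfl | ⟨l, c, rfl⟩
  · simp at hu
  have hl : (l ++ [c]).take n = l := by
    rw [List.take_append_of_le_length (by simpa using hu.ge), List.take_of_length_le]
    simpa using hu.le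
  have htake : l ++ [c] ∈ {u : List Bool | u.take n ∈ avoiding v w} ↔ l ∈ avoiding v w := by
    change (l ++ [c]).take n ∈ avoiding v w ↔ _
    rw [hl]
  have hsub : l ++ [c] ∈ avoiding v w → l ∈ avoiding v w :=
    fun h' => mem_avoiding_of_infix h' (List.prefix_append _ _).isInfix
  simp only [Set.indicator_apply, htake, concat_mem_hitting_iff h]
  split_ifs <;> first | tauto | simp

theorem mass_mul_wProb_le {p : ℝ} (hp : p ∈ Set.Ioo (0 : ℝ) 1) (A : Set (List Bool))
    (v : List Bool) (n : ℕ) :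
    mass p A n * wProb p v ≤ mass p (appendRight A v) (n + v.length) := by
  classical
  have hinj : Function.Injective (· ++ v) := List.append_left_injective v
  calc mass p A n * wProb p v
      = ∑ u ∈ words n, (appendRight A v).indicator (wProb p) (u ++ v) := by
        rw [mass, Finset.sum_mul]
        refine Finset.sum_congr rfl fun u _ => ?_
        have : u ++ v ∈ appendRight A v ↔ u ∈ A := hinj.mem_set_image
        simp only [Set.indicator_apply, this, wProb_append, ite_mul, zero_mul]
    _ = ∑ u ∈ (words n).image (· ++ v), (appendRight A v).indicator (wProb p) u :=
        (Finset.sum_image hinj.injOn).symm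
    _ ≤ mass p (appendRight A v) (n + v.length) := by
        refine Finset.sum_le_sum_of_subset_of_nonneg ?_ fun u _ _ => indicator_wProb_nonneg hp _ u
        intro u hu
        obtain ⟨x, hx, rfl⟩ := Finset.mem_image.1 hu
        rw [mem_words] at hx ⊢
        simp [hx]

theorem mass_avoiding_add_length_le {v w : List Bool} {p : ℝ} (hp : p ∈ Set.Ioo (0 : ℝ) 1)
    (n : ℕ) : mass p (avoiding v w) (n + v.length) + mass p (avoiding v w) n * wProb p v ≤
      mass p (avoiding v w) n := by
  classical
  calc _ ≤ mass p (avoiding v w) (n + v.length) +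
        mass p (appendRight (avoiding v w) v) (n + v.length) := by
        gcongr
        exact mass_mul_wProb_le hp _ _ _
    _ ≤ mass p {u | u.take n ∈ avoiding v w} (n + v.length) := by
        rw [mass, mass, mass, ← Finset.sum_add_distrib]
        refine Finset.sum_le_sum fun u hu => ?_
        rw [mem_words] at hu
        have h1 : u ∈ avoiding v w → u ∈ {u : List Bool | u.take n ∈ avoiding v w} :=
          fun h' => mem_avoiding_of_infix h' (List.take_prefix n u).isInfix
        have h2 : u ∈ appendRight (avoiding v w) v →
            u ∈ {u : List Bool | u.take n ∈ avoiding v w} ∧ u ∉ avoiding v w := by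
          rintro ⟨x, hx, rfl⟩
          refine ⟨?_, fun h' => h'.1 (List.suffix_append _ _).isInfix⟩
          have : x.length = n := by simpa using hu
          change (x ++ v).take n ∈ avoiding v w
          rwa [← this, List.take_left]
        have := (wProb_pos hp u).le
        simp only [Set.indicator_apply]
        split_ifs <;> first | tauto | simp [this]
    _ = _ := mass_take p _ n _

theorem tendsto_mass_avoiding {v w : List Bool} (h : Rivals v w) {p : ℝ}
    (hp : p ∈ Set.Ioo (0 : ℝ) 1) :
    Filter.Tendsto (mass p (avoiding v w)) Filter.atTop (nhds 0) := by
  have hanti : Antitone (mass p (avoiding v w)) := antitone_nat_of_succ_le fun n => by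
    have := mass_avoiding_succ h p n
    have := mass_nonneg hp (hitting v w) (n + 1)
    linarith
  have hlim := tendsto_atTop_ciInf hanti
    ⟨0, Set.forall_mem_range.2 fun n => mass_nonneg hp (avoiding v w) n⟩
  set a := ⨅ n, mass p (avoiding v w) n
  have ha : 0 ≤ a := ge_of_tendsto' hlim fun n => mass_nonneg hp _ n
  have hle : a + a * wProb p v ≤ a :=
    le_of_tendsto_of_tendsto'
      (((Filter.tendsto_add_atTop_iff_nat v.length).2 hlim).add (hlim.mul_const _)) hlim
      (mass_avoiding_add_length_le hp)
  have hpos := wProb_pos hp v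
  have : a = 0 := by nlinarith
  rwa [this] at hlim

theorem sum_mass_hitting {v w : List Bool} (h : Rivals v w) (p : ℝ) (n : ℕ) :
    ∑ i ∈ Finset.range (n + 1), mass p (hitting v w) i = 1 - mass p (avoiding v w) n := by
  induction n with
  | zero =>
    have : [] ∉ hitting v w := fun h' => notMem_avoiding_of_mem_hitting h h' (nil_mem_avoiding h)
    simp [mass_zero, this, nil_mem_avoiding h, wProb]
  | succ n ih =>
    rw [Finset.sum_range_succ, ih]
    linarith [mass_avoiding_succ h p n]

theorem hasSum_hitting {v w : List Bool} (h : Rivals v w) {p : ℝ} (hp : p ∈ Set.Ioo (0 : ℝ) 1) :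
    HasSum ((hitting v w).indicator (wProb p)) 1 := by
  classical
  let B (n : ℕ) : Finset (List Bool) := (Finset.range (n + 1)).biUnion words
  have hB : ∀ {n u}, u ∈ B n ↔ u.length ≤ n := by
    simp [B, mem_words]
  have hsum (n : ℕ) : ∑ u ∈ B n, (hitting v w).indicator (wProb p) u =
      1 - mass p (avoiding v w) n := by
    rw [← sum_mass_hitting h, Finset.sum_biUnion]
    · rfl
    · intro i _ j _ hij
      refine Finset.disjoint_left.2 fun u hi hj => hij ?_
      rw [← mem_words.1 hi, mem_words.1 hj]
  have hnn := indicator_wProb_nonneg hp (hitting v w)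
  have hsummable : Summable ((hitting v w).indicator (wProb p)) := by
    refine summable_of_sum_le (c := 1) hnn fun F => ?_
    have hF : F ⊆ B (F.sup List.length) := fun u hu => hB.2 (Finset.le_sup hu)
    have := Finset.sum_le_sum_of_subset_of_nonneg hF fun u _ _ => hnn u
    linarith [hsum (F.sup List.length), mass_nonneg hp (avoiding v w) (F.sup List.length)]
  have hBtop : Filter.Tendsto B Filter.atTop Filter.atTop :=
    Filter.tendsto_atTop_finset_of_monotone
      (fun m n hmn u hu => hB.2 ((hB.1 hu).trans hmn)) fun u => ⟨u.length, hB.2 le_rfl⟩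
  have hlim := hsummable.hasSum.comp hBtop
  have hlim' : Filter.Tendsto (fun n => 1 - mass p (avoiding v w) n) Filter.atTop (nhds 1) := by
    simpa using (tendsto_mass_avoiding h hp).const_sub 1
  have := tendsto_nhds_unique (hlim.congr hsum) hlim'
  exact this ▸ hsummable.hasSum

theorem win_add_win {v w : List Bool} (h : Rivals v w) {p : ℝ} (hp : p ∈ Set.Ioo (0 : ℝ) 1) :
    Win v w p + Win w v p = 1 := by
  have hs := hasSum_hitting h hp
  have key {A : Set (List Bool)} (hA : A ⊆ hitting v w) : Summable (A.indicator (wProb p)) := by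
    have := hs.summable.indicator A
    rwa [Set.indicator_indicator, Set.inter_eq_left.2 hA] at this
  rw [Win, Win, tsum_subtype _ (wProb p), tsum_subtype _ (wProb p),
    ← (key Set.subset_union_left).tsum_add (key Set.subset_union_right), ← hs.tsum_eq, hitting,
    Set.indicator_union_of_disjoint (disjoint_omegaWin h)]

/-- For every `k ≥ 2`, the pair `(ab, ba)` with `a = 0 1^k 0`, `b = 0 1^{k-1} 0 1` has a
measure-preserving bijection `Ω_{v,w}(v) → Ω_{v,w}(w)` (so `Win(v,w;p) = 1/2`), but
does not have property `R`. -/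
theorem stmt14 (k : ℕ) (hk : 2 ≤ k)
    (a b v w : List Bool)
    (hadef : a = [false] ++ List.replicate k true ++ [false])
    (hbdef : b = [false] ++ List.replicate (k - 1) true ++ [false, true])
    (hvdef : v = a ++ b) (hwdef : w = b ++ a) :
    ¬ PropR v w ∧
    (∃ φ : OmegaWin v w → OmegaWin w v,
      Function.Bijective φ ∧
      ∀ x : OmegaWin v w,
        ∀ p ∈ Set.Ioo (0:ℝ) 1, wProb p (x : List Bool) = wProb p (φ x : List Bool)) ∧
    (∀ p ∈ Set.Ioo (0:ℝ) 1, Win v w p = 1/2) := by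
  obtain rfl : a = wordA k := hadef
  obtain rfl : b = wordB k := hbdef
  subst hvdef hwdef
  obtain ⟨φ, hφ, hcontent⟩ := exists_bijective_of_ncard_level_eq (ncard_level_omegaWin_ab_eq hk)
  refine ⟨not_propR_ab hk, ⟨φ, hφ, fun x p _ => wProb_eq_of_content_eq (hcontent x) p⟩, ?_⟩
  intro p hp
  have hsum := win_add_win (rivals_wordA_wordB hk) hp
  have heq : Win (wordA k ++ wordB k) (wordB k ++ wordA k) p =
      Win (wordB k ++ wordA k) (wordA k ++ wordB k) p := by
    rw [Win, Win, ← (Equiv.ofBijective φ hφ).tsum_eq]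
    exact tsum_congr fun x => wProb_eq_of_content_eq (hcontent x) p
  linarith
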